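/- arXiv:2404.09396 — 3 statements merged into one kernel-verified Lean document; each statement's English description precedes it below -/
import Mathlib

section
/- Let a, b, c ≥ 1 be integers with a ≠ b. The graph K_c ⊕ (K_a ∪ K_b) has exactly two main Q-eigenvalues. -/
open SimpleGraph

/-- The signless Laplacian matrix `Q(G) = D(G) + A(G)` of a finite simple graph. -/
noncomputable def signlessLaplacian {V : Type*} [Fintype V] (G : SimpleGraph V) :
    Matrix V V ℝ :=
  letI := Classical.decEq V
  letI := Classical.decRel G.Adj
  Matrix.diagonal (fun v => (G.degree v : ℝ)) + G.adjMatrix ℝ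

/-- `q` is a main Q-eigenvalue of `G`: some eigenvector of `Q(G)` for `q`
has nonzero entry sum. -/
def IsMainQEigenvalue {V : Type*} [Fintype V] (G : SimpleGraph V) (q : ℝ) : Prop :=
  ∃ x : V → ℝ, (signlessLaplacian G).mulVec x = q • x ∧ (∑ v, x v) ≠ 0

/-- The number of (distinct) main Q-eigenvalues of `G`. -/
noncomputable def mainQCount {V : Type*} [Fintype V] (G : SimpleGraph V) : ℕ :=
  {q : ℝ | IsMainQEigenvalue G q}.ncard

/-- `G` contains an induced copy of `H`. -/
def HasInducedCopy {α β : Type*} (H : SimpleGraph α) (G : SimpleGraph β) : Prop :=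
  ∃ f : α ↪ β, ∀ a b : α, H.Adj a b ↔ G.Adj (f a) (f b)

/-- A cograph is a `P₄`-free graph. -/
def IsCograph {V : Type*} (G : SimpleGraph V) : Prop :=
  ¬ HasInducedCopy (SimpleGraph.pathGraph 4) G

/-- A quasi-threshold graph is a `{P₄, C₄}`-free graph. -/
def IsQuasiThreshold {V : Type*} (G : SimpleGraph V) : Prop :=
  ¬ HasInducedCopy (SimpleGraph.pathGraph 4) G ∧
  ¬ HasInducedCopy (SimpleGraph.cycleGraph 4) G

/-- A chordal graph: no induced cycle of length at least 4. -/
def IsChordal {V : Type*} (G : SimpleGraph V) : Prop :=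
  ∀ n : ℕ, 4 ≤ n → ¬ HasInducedCopy (SimpleGraph.cycleGraph n) G

/-- The join `G ⊕ H` of two vertex-disjoint graphs. -/
def graphJoin {V W : Type*} (G : SimpleGraph V) (H : SimpleGraph W) :
    SimpleGraph (V ⊕ W) where
  Adj x y :=
    match x, y with
    | Sum.inl a, Sum.inl b => G.Adj a b
    | Sum.inr a, Sum.inr b => H.Adj a b
    | Sum.inl _, Sum.inr _ => True
    | Sum.inr _, Sum.inl _ => True
  symm := by
    refine ⟨?_⟩
    rintro (a | a) (b | b) h
    · exact G.symm.symm _ _ h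
    · trivial
    · trivial
    · exact H.symm.symm _ _ h
  loopless := by
    refine ⟨?_⟩
    rintro (a | a) h
    · exact G.loopless.irrefl a h
    · exact H.loopless.irrefl a h

/-- The disjoint union `G ∪ H` of two vertex-disjoint graphs. -/
def disjUnionGraph {V W : Type*} (G : SimpleGraph V) (H : SimpleGraph W) :
    SimpleGraph (V ⊕ W) where
  Adj x y :=
    match x, y with
    | Sum.inl a, Sum.inl b => G.Adj a b
    | Sum.inr a, Sum.inr b => H.Adj a b
    | _, _ => False
  symm := by
    refine ⟨?_⟩
    rintro (a | a) (b | b) h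
    · exact G.symm.symm _ _ h
    · exact h.elim
    · exact h.elim
    · exact H.symm.symm _ _ h
  loopless := by
    refine ⟨?_⟩
    rintro (a | a) h
    · exact G.loopless.irrefl a h
    · exact H.loopless.irrefl a h

/-- `tK_a`: the disjoint union of `t` copies of the complete graph `K_a`. -/
def copiesComplete (t a : ℕ) : SimpleGraph (Fin t × Fin a) where
  Adj x y := x.1 = y.1 ∧ x.2 ≠ y.2
  symm := ⟨fun _ _ ⟨h1, h2⟩ => ⟨h1.symm, h2.symm⟩⟩
  loopless := ⟨fun _ ⟨_, h⟩ => h rfl⟩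

/-- The disjoint union `a₁ K_{n₁} ∪ ⋯ ∪ a_p K_{n_p}`: for each `i : Fin p`,
`a i` copies of the complete graph on `n i` vertices. Two vertices are adjacent
iff they lie in the same copy of the same complete graph and are distinct. -/
def satellites (p : ℕ) (a n : Fin p → ℕ) :
    SimpleGraph ((i : Fin p) × (Fin (a i) × Fin (n i))) where
  Adj x y := x.1 = y.1 ∧ HEq x.2.1 y.2.1 ∧ ¬ HEq x.2.2 y.2.2
  symm := ⟨fun _ _ ⟨h1, h2, h3⟩ => ⟨h1.symm, h2.symm, fun h => h3 h.symm⟩⟩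
  loopless := ⟨fun _ ⟨_, _, h3⟩ => h3 HEq.rfl⟩


open Classical in
theorem sl_mulVec {V : Type*} [Fintype V] (G : SimpleGraph V) (x : V → ℝ) (v : V) :
    (signlessLaplacian G).mulVec x v = ∑ w, if G.Adj v w then (x v + x w) else 0 := by
  unfold signlessLaplacian
  simp only [Matrix.add_mulVec, Pi.add_apply, Matrix.mulVec_diagonal]
  have h1 : ((G.degree v : ℕ) : ℝ) = ∑ w, if G.Adj v w then (1:ℝ) else 0 := by
    rw [← G.card_neighborFinset_eq_degree, Finset.sum_boole]
    congr 2
    ext w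
    simp
  have h2 : ∑ w, (if G.Adj v w then (x v + x w) else 0)
      = (∑ w, if G.Adj v w then (1:ℝ) else 0) * x v + ∑ w, (if G.Adj v w then (1:ℝ) else 0) * x w := by
    rw [Finset.sum_mul, ← Finset.sum_add_distrib]
    refine Finset.sum_congr rfl fun w _ => ?_
    split_ifs <;> ring
  rw [h2, ← h1]
  congr 1

open Classical in
theorem top_sum {n : ℕ} (f : Fin n → ℝ) (i : Fin n) :
    (∑ j, if (⊤ : SimpleGraph (Fin n)).Adj i j then (f i + f j) else 0)
      = ((n:ℝ) - 2) * f i + ∑ j, f j := by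
  have h : ∀ j, (if (⊤ : SimpleGraph (Fin n)).Adj i j then (f i + f j) else 0)
      = (f i + f j) - if i = j then 2 * f i else 0 := by
    intro j
    by_cases hij : i = j
    · subst hij; simp; ring
    · simp [hij]
  simp only [h, Finset.sum_sub_distrib, Finset.sum_add_distrib, Finset.sum_ite_eq]
  simp
  ring

theorem gj1 {V W : Type*} (G : SimpleGraph V) (H : SimpleGraph W) (x y : V) :
    (graphJoin G H).Adj (.inl x) (.inl y) ↔ G.Adj x y := Iff.rfl
theorem gj2 {V W : Type*} (G : SimpleGraph V) (H : SimpleGraph W) (x y : W) :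
    (graphJoin G H).Adj (.inr x) (.inr y) ↔ H.Adj x y := Iff.rfl
theorem gj3 {V W : Type*} (G : SimpleGraph V) (H : SimpleGraph W) (x : V) (y : W) :
    (graphJoin G H).Adj (.inl x) (.inr y) ↔ True := Iff.rfl
theorem gj4 {V W : Type*} (G : SimpleGraph V) (H : SimpleGraph W) (x : W) (y : V) :
    (graphJoin G H).Adj (.inr x) (.inl y) ↔ True := Iff.rfl
theorem du1 {V W : Type*} (G : SimpleGraph V) (H : SimpleGraph W) (x y : V) :
    (disjUnionGraph G H).Adj (.inl x) (.inl y) ↔ G.Adj x y := Iff.rfl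
theorem du2 {V W : Type*} (G : SimpleGraph V) (H : SimpleGraph W) (x y : W) :
    (disjUnionGraph G H).Adj (.inr x) (.inr y) ↔ H.Adj x y := Iff.rfl
theorem du3 {V W : Type*} (G : SimpleGraph V) (H : SimpleGraph W) (x : V) (y : W) :
    (disjUnionGraph G H).Adj (.inl x) (.inr y) ↔ False := Iff.rfl
theorem du4 {V W : Type*} (G : SimpleGraph V) (H : SimpleGraph W) (x : W) (y : V) :
    (disjUnionGraph G H).Adj (.inr x) (.inl y) ↔ False := Iff.rfl

theorem main_iff (a b c : ℕ) (ha : 1 ≤ a) (hb : 1 ≤ b) (hc : 1 ≤ c) (q t : ℝ)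
    (hq : q = t + (a + b + c - 2)) :
    IsMainQEigenvalue (graphJoin (⊤ : SimpleGraph (Fin c))
      (disjUnionGraph (⊤ : SimpleGraph (Fin a)) (⊤ : SimpleGraph (Fin b)))) q ↔
    t * t - c * t - (((b:ℝ) - a)^2 + c * (a + b)) = 0 := by
  have ha' : (1:ℝ) ≤ a := by exact_mod_cast ha
  have hb' : (1:ℝ) ≤ b := by exact_mod_cast hb
  have hc' : (1:ℝ) ≤ c := by exact_mod_cast hc
  have key : ∀ x : (Fin c ⊕ (Fin a ⊕ Fin b)) → ℝ,
      ((signlessLaplacian (graphJoin (⊤ : SimpleGraph (Fin c))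
      (disjUnionGraph (⊤ : SimpleGraph (Fin a)) (⊤ : SimpleGraph (Fin b))))).mulVec x = q • x) ↔
      (∀ i, t * x (.inl i) = ∑ i, x (.inl i) + (∑ i, x (.inr (.inl i)) + ∑ i, x (.inr (.inr i)))) ∧
      (∀ i, (t + b) * x (.inr (.inl i)) = ∑ i, x (.inl i) + ∑ i, x (.inr (.inl i))) ∧
      (∀ i, (t + a) * x (.inr (.inr i)) = ∑ i, x (.inl i) + ∑ i, x (.inr (.inr i))) := by
    intro x
    rw [funext_iff, Sum.forall, Sum.forall]
    simp only [sl_mulVec, Fintype.sum_sum_type, gj1, gj2, gj3, gj4, du1, du2, du3, du4, Pi.smul_apply,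
      smul_eq_mul, if_true, if_false, Finset.sum_const_zero]
    refine and_congr (forall_congr' fun i => ?_) (and_congr (forall_congr' fun i => ?_)
      (forall_congr' fun i => ?_))
    · have := top_sum (fun i => x (.inl i)) i
      rw [this, hq]
      simp only [Finset.sum_add_distrib, Finset.sum_const, Finset.card_univ, Fintype.card_fin,
        nsmul_eq_mul]
      constructor <;> intro h <;> linarith
    · have := top_sum (fun i => x (.inr (.inl i))) i
      rw [this, hq]
      simp only [Finset.sum_add_distrib, Finset.sum_const, Finset.card_univ, Fintype.card_fin,
        nsmul_eq_mul]
      constructor <;> intro h <;> linarith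
    · have := top_sum (fun i => x (.inr (.inr i))) i
      rw [this, hq]
      simp only [Finset.sum_add_distrib, Finset.sum_const, Finset.card_univ, Fintype.card_fin,
        nsmul_eq_mul]
      constructor <;> intro h <;> linarith
  unfold IsMainQEigenvalue
  simp only [key, Fintype.sum_sum_type]
  constructor
  · rintro ⟨x, ⟨h1, h2, h3⟩, hS⟩
    have e1 := Finset.sum_congr (rfl : (Finset.univ : Finset (Fin c)) = _) (fun i _ => h1 i)
    have e2 := Finset.sum_congr (rfl : (Finset.univ : Finset (Fin a)) = _) (fun i _ => h2 i)
    have e3 := Finset.sum_congr (rfl : (Finset.univ : Finset (Fin b)) = _) (fun i _ => h3 i)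
    simp only [← Finset.mul_sum, Finset.sum_const, Finset.card_univ, Fintype.card_fin,
        nsmul_eq_mul] at e1 e2 e3
    generalize ∑ i, x (.inl i) = C at *
    generalize ∑ i, x (.inr (.inl i)) = A at *
    generalize ∑ i, x (.inr (.inr i)) = B at *
    have hne : t * C ≠ 0 := by
      rw [e1]; exact mul_ne_zero (by positivity) hS
    have h0 : t * C * (t * t - c * t - (((b:ℝ) - a)^2 + c * (a + b))) = 0 := by
      linear_combination (t^2 - ((b:ℝ)-a)^2) * e1 + c * (t - (b - a)) * e2 + c * (t + (b-a)) * e3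
    exact (mul_eq_zero.mp h0).resolve_left hne
  · intro h
    set d : ℝ := (b:ℝ) - a with hd
    have hpos : (0:ℝ) < d^2 + c * (a+b) := by positivity
    have ht : t ≠ 0 := by rintro rfl; nlinarith
    have htd : t^2 - d^2 ≠ 0 := by
      intro h0
      have h4 : (c:ℝ) * (t + (a + b)) = 0 := by linarith
      have h5 : t + (a + b) = 0 := (mul_eq_zero.mp h4).resolve_left (by positivity)
      have h6 : t = -(a+b) := by linarith
      rw [h6, hd] at h0
      nlinarith
    have hsum : (c:ℝ) * (t^2 - d^2) + (a * (c * (t - d)) + b * (c * (t + d))) = t * (t^2 - d^2) := by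
      rw [hd] at h ⊢
      linear_combination (-t) * h
    refine ⟨Sum.elim (fun _ => t^2 - d^2) (Sum.elim (fun _ => c * (t - d)) (fun _ => c * (t + d))), ?_⟩
    simp only [Sum.elim_inl, Sum.elim_inr, Finset.sum_const, Finset.card_univ, Fintype.card_fin,
        nsmul_eq_mul, hsum]
    refine ⟨⟨fun _ => trivial, fun _ => ?_, fun _ => ?_⟩, mul_ne_zero ht htd⟩
    · rw [hd]; ring
    · rw [hd]; ring

theorem join_complete_union_two_completes_two_main
    (a b c : ℕ) (ha : 1 ≤ a) (hb : 1 ≤ b) (hc : 1 ≤ c) (hab : a ≠ b) :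
    mainQCount (graphJoin (⊤ : SimpleGraph (Fin c))
      (disjUnionGraph (⊤ : SimpleGraph (Fin a)) (⊤ : SimpleGraph (Fin b)))) = 2 := by
  have ha' : (1:ℝ) ≤ a := by exact_mod_cast ha
  have hb' : (1:ℝ) ≤ b := by exact_mod_cast hb
  have hc' : (1:ℝ) ≤ c := by exact_mod_cast hc
  set D : ℝ := (c:ℝ)^2 + 4 * (((b:ℝ) - a)^2 + c * (a + b)) with hD
  have hDpos : 0 < D := by positivity
  have hs : 0 < Real.sqrt D := Real.sqrt_pos.mpr hDpos
  have hss : Real.sqrt D * Real.sqrt D = D := Real.mul_self_sqrt hDpos.le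
  unfold mainQCount
  have : {q : ℝ | IsMainQEigenvalue (graphJoin (⊤ : SimpleGraph (Fin c))
      (disjUnionGraph (⊤ : SimpleGraph (Fin a)) (⊤ : SimpleGraph (Fin b)))) q} =
      {(a + b + c - 2 : ℝ) + (c + Real.sqrt D) / 2, (a + b + c - 2 : ℝ) + (c - Real.sqrt D) / 2} := by
    ext q
    rw [Set.mem_setOf_eq, main_iff a b c ha hb hc q (q - (a + b + c - 2)) (by ring)]
    generalize Real.sqrt D = s at *
    simp only [Set.mem_insert_iff, Set.mem_singleton_iff]
    rw [← sub_eq_zero (a := q), ← sub_eq_zero (a := q) (b := _ + (c - s)/2), ← mul_eq_zero]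
    rw [hD] at hss
    constructor <;> intro h
    · linear_combination h - hss / 4
    · linear_combination h + hss / 4
  rw [this, Set.ncard_pair]
  intro h
  linarith
end

section
/- A finite simple graph G (with at least one vertex) has exactly one main Q-eigenvalue if and only if G is regular. -/
open SimpleGraph

lemma aux_symm {V : Type*} [Fintype V] (G : SimpleGraph V) :
    (signlessLaplacian G).transpose = signlessLaplacian G := by
  classical
  unfold signlessLaplacian
  simp [Matrix.transpose_add]

lemma aux_one {V : Type*} [Fintype V] (G : SimpleGraph V) [DecidableRel G.Adj] (v : V) :
    (signlessLaplacian G).mulVec (fun _ => (1:ℝ)) v = 2 * (G.degree v : ℝ) := by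
  classical
  have h : (signlessLaplacian G) =
      Matrix.diagonal (fun v => (G.degree v : ℝ)) + G.adjMatrix ℝ := by
    unfold signlessLaplacian
    congr!
  rw [h, Matrix.add_mulVec, Pi.add_apply, Matrix.mulVec_diagonal,
    SimpleGraph.adjMatrix_mulVec_apply]
  simp
  ring

lemma aux_dot {V : Type*} [Fintype V] (G : SimpleGraph V) (x y : V → ℝ) :
    (signlessLaplacian G).mulVec x ⬝ᵥ y = x ⬝ᵥ (signlessLaplacian G).mulVec y := by
  rw [Matrix.dotProduct_mulVec, ← Matrix.mulVec_transpose, aux_symm]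

theorem one_main_Q_eigenvalue_iff_regular
    {V : Type*} [Fintype V] [Nonempty V] (G : SimpleGraph V) [DecidableRel G.Adj] :
    mainQCount G = 1 ↔ ∀ u v : V, G.degree u = G.degree v := by
  classical
  unfold mainQCount
  rw [Set.ncard_eq_one]
  constructor
  · rintro ⟨q, hq⟩
    have hH : (signlessLaplacian G).IsHermitian := by
      rw [Matrix.IsHermitian, Matrix.conjTranspose_eq_transpose_of_trivial, aux_symm]
    set w : V → ℝ := (signlessLaplacian G).mulVec (fun _ => (1:ℝ)) - q • (fun _ => (1:ℝ)) with hw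
    have key : ∀ i, (hH.eigenvectorBasis i).ofLp ⬝ᵥ w = 0 := by
      intro i
      have hm := hH.mulVec_eigenvectorBasis i
      rw [hw, dotProduct_sub, ← aux_dot, hm, smul_dotProduct, dotProduct_smul]
      by_cases hs : ∑ v, (hH.eigenvectorBasis i).ofLp v = 0
      · simp [dotProduct, hs]
      · have : hH.eigenvalues i ∈ {q : ℝ | IsMainQEigenvalue G q} := ⟨_, hm, hs⟩
        rw [hq] at this
        rw [Set.mem_singleton_iff.1 this]; simp
    have hw0 : WithLp.toLp 2 w = (0 : EuclideanSpace ℝ V) := by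
      apply InnerProductSpace.ext_inner_left_basis hH.eigenvectorBasis.toBasis
      intro i
      simpa [PiLp.inner_apply, dotProduct, mul_comm] using key i
    have hw1 : ∀ v, w v = 0 := fun v => congrArg (fun z : EuclideanSpace ℝ V => z v) hw0
    have h2 : ∀ v, 2 * (G.degree v : ℝ) = q := by
      intro v
      have := hw1 v
      rw [hw, Pi.sub_apply, aux_one] at this
      simp at this
      linarith
    intro u v
    have := h2 u
    have := h2 v
    have : (G.degree u : ℝ) = G.degree v := by linarith
    exact_mod_cast this
  · intro h
    obtain ⟨u⟩ := ‹Nonempty V›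
    have h1 : (signlessLaplacian G).mulVec (fun _ => (1:ℝ)) =
        (2 * (G.degree u : ℝ)) • (fun _ => (1:ℝ)) := by
      funext v
      rw [aux_one, h v u]; simp
    refine ⟨2 * (G.degree u : ℝ), ?_⟩
    ext q
    rw [Set.mem_singleton_iff]
    constructor
    · rintro ⟨x, hx, hs⟩
      have := aux_dot G x (fun _ => 1)
      rw [hx, h1, smul_dotProduct, dotProduct_smul] at this
      have h3 : x ⬝ᵥ (fun _ => (1:ℝ)) = ∑ v, x v := by simp [dotProduct]
      rw [h3] at this
      exact mul_right_cancel₀ hs this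
    · rintro rfl
      have : Nonempty V := ⟨u⟩
      exact ⟨_, h1, by simp⟩
end

section
/- For every finite simple graph G, the number of main Q-eigenvalues of G equals the number of main Q-eigenvalues of its complement Ḡ. -/
open SimpleGraph

theorem aux {E : Type*} [NormedAddCommGroup E] [InnerProductSpace ℝ E] [FiniteDimensional ℝ E]
    (T T' : E →ₗ[ℝ] E) (hT : T.IsSymmetric) (hT' : T'.IsSymmetric) (j : E) (c : ℝ)
    (h : ∀ x, T x = c • x + (inner ℝ j x : ℝ) • j - T' x) :
    {q : ℝ | ∃ x, T x = q • x ∧ (inner ℝ j x : ℝ) ≠ 0}.ncard ≤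
    {q : ℝ | ∃ x, T' x = q • x ∧ (inner ℝ j x : ℝ) ≠ 0}.ncard := by
  classical
  have htop : (⨆ μ, Module.End.eigenspace T' μ) = ⊤ := by
    rw [← Submodule.orthogonal_eq_bot_iff]
    exact hT'.orthogonalComplement_iSup_eigenspaces_eq_bot
  have hj : j ∈ (⨆ μ, Module.End.eigenspace T' μ) := htop ▸ Submodule.mem_top
  rw [Submodule.mem_iSup_iff_exists_finsupp] at hj
  obtain ⟨f, hf, hs⟩ := hj
  have hf' : ∀ q, T' (f q) = q • f q := fun q => Module.End.mem_eigenspace_iff.mp (hf q)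
  have horth : ∀ p q, p ≠ q → (inner ℝ (f p) (f q) : ℝ) = 0 := by
    intro p q hpq
    have := hT' (f p) (f q)
    rw [hf', hf', inner_smul_left, inner_smul_right] at this
    simp at this
    tauto
  let W : Submodule ℝ E := Submodule.span ℝ (f.support.image f : Set E)
  have hfW : ∀ q, f q ∈ W := by
    intro q
    by_cases hq : f q = 0
    · rw [hq]; exact W.zero_mem
    · apply Submodule.subset_span
      simp only [Finset.coe_image]
      exact ⟨q, by simpa using hq, rfl⟩
  have hjW : j ∈ W := by
    rw [← hs]
    exact W.sum_mem fun q _ => hfW q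
  have hWT' : ∀ w ∈ W, T' w ∈ W := by
    intro w hw
    have : W ≤ W.comap T' := by
      refine Submodule.span_le.mpr ?_
      intro x hx
      simp only [Finset.coe_image] at hx
      obtain ⟨q, -, rfl⟩ := hx
      simp only [Submodule.comap_coe, Set.mem_preimage, SetLike.mem_coe]
      rw [hf']
      exact W.smul_mem _ (hfW q)
    exact this hw
  have hWT : ∀ w ∈ W, T w ∈ W := by
    intro w hw
    rw [h]
    exact W.sub_mem (W.add_mem (W.smul_mem _ hw) (W.smul_mem _ hjW)) (hWT' w hw)
  have hfin : ∀ A : E →ₗ[ℝ] E, {q : ℝ | ∃ x, A x = q • x ∧ (inner ℝ j x : ℝ) ≠ 0}.Finite := by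
    intro A
    refine (Module.End.finite_hasEigenvalue A).subset ?_
    rintro q ⟨x, hx, hx0⟩
    refine Module.End.hasEigenvalue_of_hasEigenvector (x := x)
      ⟨Module.End.mem_eigenspace_iff.mpr hx, ?_⟩
    rintro rfl
    simp at hx0
  have hW1 : Module.finrank ℝ W ≤
      {q : ℝ | ∃ x, T' x = q • x ∧ (inner ℝ j x : ℝ) ≠ 0}.ncard := by
    refine (finrank_span_finset_le_card _).trans (Finset.card_image_le.trans ?_)
    rw [← Set.ncard_coe_finset]
    refine Set.ncard_le_ncard ?_ (hfin T')
    intro q hq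
    refine ⟨f q, hf' q, ?_⟩
    have hq0 : f q ≠ 0 := by simpa using hq
    rw [← hs, Finsupp.sum, sum_inner, Finset.sum_eq_single q]
    · simpa using hq0
    · intro p _ hp
      exact horth p q hp
    · intro hn
      exact absurd hq hn
  refine le_trans ?_ hW1
  let R : W →ₗ[ℝ] W := T.restrict hWT
  have key : ∀ q ∈ {q : ℝ | ∃ x, T x = q • x ∧ (inner ℝ j x : ℝ) ≠ 0},
      ∃ w : W, Module.End.HasEigenvector R q w := by
    rintro q ⟨x, hx, hx0⟩
    apply Module.End.HasEigenvalue.exists_hasEigenvector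
    by_contra hne
    have hker : LinearMap.ker (R - q • (1 : Module.End ℝ W)) = ⊥ := by
      rw [← Module.End.eigenspace_def]
      simpa [Module.End.hasEigenvalue_iff] using hne
    have hsurj := LinearMap.injective_iff_surjective.mp (LinearMap.ker_eq_bot.mp hker)
    obtain ⟨w, hw⟩ := hsurj ⟨j, hjW⟩
    have hw' : T w - q • (w : E) = j := by
      have := congrArg Subtype.val hw
      simpa [R] using this
    apply hx0
    rw [← hw', inner_sub_left, hT, hx, inner_smul_left, inner_smul_right]
    simp
  choose! g hg using key
  have hli := Module.End.eigenvectors_linearIndependent' R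
    (fun q : {q : ℝ | ∃ x, T x = q • x ∧ (inner ℝ j x : ℝ) ≠ 0} => (q : ℝ))
    Subtype.val_injective (fun q => g q) (fun q => hg q q.2)
  have := (hfin T).fintype
  rw [← Nat.card_coe_set_eq, Nat.card_eq_fintype_card]
  exact hli.fintype_card_le_finrank

theorem sl_apply {V : Type*} [Fintype V] (G : SimpleGraph V) (x : V → ℝ) (v : V) :
    (signlessLaplacian G).mulVec x v =
      by classical exact ∑ w, (if G.Adj v w then x v + x w else 0) := by
  classical
  unfold signlessLaplacian
  simp only [Matrix.add_mulVec, Pi.add_apply, Matrix.mulVec_diagonal]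
  rw [SimpleGraph.adjMatrix_mulVec_apply]
  rw [← Finset.sum_filter, Finset.sum_add_distrib, Finset.sum_const, nsmul_eq_mul]
  congr 1
  · rw [← SimpleGraph.card_neighborFinset_eq_degree]
    congr 3
    ext; simp
  · congr 1
    ext; simp

theorem sl_compl {V : Type*} [Fintype V] (G : SimpleGraph V) (x : V → ℝ) (v : V) :
    (signlessLaplacian G).mulVec x v =
      ((Fintype.card V : ℝ) - 2) * x v + (∑ w, x w) - (signlessLaplacian Gᶜ).mulVec x v := by
  classical
  rw [eq_sub_iff_add_eq, sl_apply, sl_apply, ← Finset.sum_add_distrib]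
  have : ∀ w, ((if G.Adj v w then x v + x w else 0) + (if Gᶜ.Adj v w then x v + x w else 0))
      = x v + x w - (if v = w then 2 * x v else 0) := by
    intro w
    by_cases hvw : v = w
    · subst hvw; simp; ring
    · by_cases ha : G.Adj v w <;> simp [ha, hvw]
  trans ∑ w, (x v + x w - (if v = w then 2 * x v else 0))
  · refine Finset.sum_congr rfl fun w _ => ?_
    convert this w
  simp [Finset.sum_sub_distrib, Finset.sum_add_distrib]
  ring

theorem sl_symm {V : Type*} [Fintype V] (G : SimpleGraph V) :
    (signlessLaplacian G).IsHermitian := by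
  classical
  unfold signlessLaplacian
  refine Matrix.IsHermitian.add (Matrix.isHermitian_diagonal _) ?_
  rw [Matrix.IsHermitian, Matrix.conjTranspose_eq_transpose_of_trivial]
  exact SimpleGraph.transpose_adjMatrix ..

theorem main_le {V : Type*} [Fintype V] (G : SimpleGraph V) :
    mainQCount G ≤ mainQCount Gᶜ := by
  classical
  let j : EuclideanSpace ℝ V := WithLp.toLp 2 (fun _ => (1 : ℝ))
  have hin : ∀ x : EuclideanSpace ℝ V, (inner ℝ j x : ℝ) = ∑ v, x v := by
    intro x
    simp [j, PiLp.inner_apply]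
  have hset : ∀ H : SimpleGraph V, {q : ℝ | IsMainQEigenvalue H q} =
      {q : ℝ | ∃ x, Matrix.toEuclideanLin (signlessLaplacian H) x = q • x ∧
        (inner ℝ j x : ℝ) ≠ 0} := by
    intro H
    ext q
    constructor
    · rintro ⟨x, hx, h0⟩
      refine ⟨WithLp.toLp 2 x, ?_, by rw [hin]; exact h0⟩
      ext v
      exact congrFun hx v
    · rintro ⟨x, hx, h0⟩
      refine ⟨x.ofLp, ?_, by rw [hin] at h0; exact h0⟩
      exact congrArg WithLp.ofLp hx
  unfold mainQCount
  rw [hset, hset]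
  refine aux _ _ (Matrix.isSymmetric_toEuclideanLin_iff.mpr (sl_symm G))
    (Matrix.isSymmetric_toEuclideanLin_iff.mpr (sl_symm Gᶜ)) j ((Fintype.card V : ℝ) - 2) ?_
  intro x
  ext v
  rw [hin]
  have := sl_compl G x.ofLp v
  simpa [j, Matrix.toLpLin_apply] using this

theorem main_count_compl
    {V : Type*} [Fintype V] (G : SimpleGraph V) :
    mainQCount G = mainQCount Gᶜ := by
  refine le_antisymm (main_le G) ?_
  have := main_le Gᶜ
  rwa [compl_compl] at this
end
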